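/- Let V ⊆ ℂ be an open set and let G be a nonconstant holomorphic function on V whose derivative G' is nowhere vanishing. Set u = log((1 + |G|²)/(2|G'|)). Then on V: −2(∂²_zz u + (∂_z u)²) = {G, z}, where {G, z} = (G''/G')' − (1/2)(G''/G')² is the Schwarzian derivative of G. (This expresses that for a minimal surface with Hopf differential Q = dz², the entropy differential equals P = {G, z} dz², where G is the stereographically projected Gauss map.) -/

import Mathlib

/-- The Wirtinger derivative `∂_z f = (1/2)(∂_x f - i ∂_y f)`. -/
noncomputable def wirtingerZ (f : ℂ → ℂ) (z : ℂ) : ℂ :=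
  (1 / 2) * (fderiv ℝ f z 1 - Complex.I * fderiv ℝ f z Complex.I)

/-- The Schwarzian derivative `{G, z} = (G''/G')' - (1/2)(G''/G')²`. -/
noncomputable def schwarzian (G : ℂ → ℂ) (z : ℂ) : ℂ :=
  deriv (fun w => deriv (deriv G) w / deriv G w) z
    - (1 / 2) * (deriv (deriv G) z / deriv G z) ^ 2

/-- `f` is real-differentiable at `z` with differential `a dz + b dz̄`. -/
def HasWirtingerAt (f : ℂ → ℂ) (a b z : ℂ) : Prop :=
  HasFDerivAt f (a • ContinuousLinearMap.id ℝ ℂ + b • (Complex.conjCLE : ℂ →L[ℝ] ℂ)) z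

namespace HasWirtingerAt

variable {f g : ℂ → ℂ} {a b c d z : ℂ}

theorem wirtingerZ_eq (h : HasWirtingerAt f a b z) : wirtingerZ f z = a := by
  unfold HasWirtingerAt at h
  rw [wirtingerZ, h.fderiv]
  simp
  linear_combination (b / 2 - a / 2) * Complex.I_mul_I

theorem of_hasDerivAt (h : HasDerivAt f a z) : HasWirtingerAt f a 0 z := by
  refine (h.hasFDerivAt.restrictScalars ℝ).congr_fderiv ?_
  ext
  simp [mul_comm]

theorem conj (h : HasWirtingerAt f a b z) :
    HasWirtingerAt (fun w => starRingEnd ℂ (f w)) (starRingEnd ℂ b) (starRingEnd ℂ a) z := by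
  refine ((Complex.conjCLE : ℂ →L[ℝ] ℂ).hasFDerivAt.comp z h).congr_fderiv ?_
  ext
  simp
  ring

theorem sub (hf : HasWirtingerAt f a b z) (hg : HasWirtingerAt g c d z) :
    HasWirtingerAt (fun w => f w - g w) (a - c) (b - d) z := by
  refine (HasFDerivAt.sub hf hg).congr_fderiv ?_
  module

theorem mul (hf : HasWirtingerAt f a b z) (hg : HasWirtingerAt g c d z) :
    HasWirtingerAt (fun w => f w * g w) (a * g z + f z * c) (b * g z + f z * d) z := by
  refine (HasFDerivAt.mul hf hg).congr_fderiv ?_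
  module

theorem comp (hf : HasWirtingerAt f a b z) {h : ℂ → ℂ} {h' : ℂ} (hh : HasDerivAt h h' (f z)) :
    HasWirtingerAt (fun w => h (f w)) (h' * a) (h' * b) z := by
  refine ((hh.hasFDerivAt.restrictScalars ℝ).comp z hf).congr_fderiv ?_
  ext
  simp
  ring

theorem congr_of_eventuallyEq (hf : HasWirtingerAt f a b z) (h : g =ᶠ[nhds z] f) :
    HasWirtingerAt g a b z :=
  HasFDerivAt.congr_of_eventuallyEq hf h

end HasWirtingerAt

theorem Complex.one_add_mul_conj (w : ℂ) :
    1 + w * starRingEnd ℂ w = ((1 + ‖w‖ ^ 2 : ℝ) : ℂ) := by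
  rw [Complex.mul_conj']; push_cast; rfl

theorem Complex.one_add_mul_conj_ne_zero (w : ℂ) : 1 + w * starRingEnd ℂ w ≠ 0 := by
  rw [Complex.one_add_mul_conj, Complex.ofReal_ne_zero]
  positivity

theorem ofReal_log_one_add_norm_sq_div (w v : ℂ) (hv : v ≠ 0) :
    ((Real.log ((1 + ‖w‖ ^ 2) / (2 * ‖v‖)) : ℝ) : ℂ) =
      Complex.log (1 + w * starRingEnd ℂ w) -
        (1 / 2 * Complex.log (v * starRingEnd ℂ v) + Complex.log 2) := by
  have hv' : ‖v‖ ≠ 0 := norm_ne_zero_iff.mpr hv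
  rw [Complex.one_add_mul_conj, Complex.mul_conj', ← Complex.ofReal_pow,
    ← Complex.ofReal_ofNat, ← Complex.ofReal_log (by positivity),
    ← Complex.ofReal_log (by positivity), ← Complex.ofReal_log (by positivity),
    Real.log_div (by positivity) (by positivity), Real.log_mul (by norm_num) hv', Real.log_pow]
  push_cast
  ring

/-- The first Wirtinger derivative of the logarithmic conformal factor of a minimal surface. -/
theorem wirtingerZ_log_one_add_norm_sq_div {G : ℂ → ℂ} {z : ℂ}
    (hG : DifferentiableAt ℂ G z) (hG' : DifferentiableAt ℂ (deriv G) z) (hne : deriv G z ≠ 0) :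
    wirtingerZ (fun w => ((Real.log ((1 + ‖G w‖ ^ 2) / (2 * ‖deriv G w‖)) : ℝ) : ℂ)) z =
      starRingEnd ℂ (G z) * deriv G z * (1 + G z * starRingEnd ℂ (G z))⁻¹ -
        1 / 2 * (deriv (deriv G) z / deriv G z) := by
  have hW := HasWirtingerAt.of_hasDerivAt hG.hasDerivAt
  have hW' := HasWirtingerAt.of_hasDerivAt hG'.hasDerivAt
  have hslit : 1 + G z * starRingEnd ℂ (G z) ∈ Complex.slitPlane := by
    rw [Complex.one_add_mul_conj, Complex.ofReal_mem_slitPlane]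
    positivity
  have hslit' : deriv G z * starRingEnd ℂ (deriv G z) ∈ Complex.slitPlane := by
    rw [Complex.mul_conj', ← Complex.ofReal_pow, Complex.ofReal_mem_slitPlane]
    positivity
  have hlog := (hW.mul hW.conj).comp (h := fun t => Complex.log (1 + t))
    (((hasDerivAt_id _).const_add 1).clog hslit)
  have hlog' := (hW'.mul hW'.conj).comp (h := fun t => 1 / 2 * Complex.log t + Complex.log 2)
    (((Complex.hasDerivAt_log hslit').const_mul (1 / 2)).add_const _)
  have hev : ∀ᶠ w in nhds z, deriv G w ≠ 0 := hG'.continuousAt.eventually_ne hne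
  rw [((hlog.sub hlog').congr_of_eventuallyEq
    (hev.mono fun w hw => ofReal_log_one_add_norm_sq_div _ _ hw)).wirtingerZ_eq]
  have hconj : starRingEnd ℂ (deriv G z) ≠ 0 := (map_ne_zero _).mpr hne
  have hD := Complex.one_add_mul_conj_ne_zero (G z)
  simp only [map_zero, mul_zero, add_zero]
  field_simp

/-- For a nonconstant holomorphic function `G` on an open set `V` with nowhere
vanishing derivative, the function `u = log((1+|G|²)/(2|G'|))` satisfies
`-2(∂²_zz u + (∂_z u)²) = {G, z}` on `V`. That is, for a minimal surface with
Hopf differential `dz²`, the entropy differential is the Schwarzian of the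
Gauss map. -/
theorem entropy_differential_eq_schwarzian
    (V : Set ℂ) (hV : IsOpen V) (G : ℂ → ℂ)
    (hG : DifferentiableOn ℂ G V)
    (hG'ne : ∀ z ∈ V, deriv G z ≠ 0)
    (hGnc : ¬ ∃ c : ℂ, Set.EqOn G (fun _ => c) V)
    (u : ℂ → ℝ)
    (hu : ∀ z, u z = Real.log ((1 + ‖G z‖ ^ 2) / (2 * ‖deriv G z‖))) :
    ∀ z ∈ V,
      -2 * (wirtingerZ (wirtingerZ (fun w => (u w : ℂ))) z
          + (wirtingerZ (fun w => (u w : ℂ)) z) ^ 2)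
        = schwarzian G z := by
  intro z hz
  have hG' : DifferentiableOn ℂ (deriv G) V := hG.deriv hV
  have hG'' : DifferentiableOn ℂ (deriv (deriv G)) V := hG'.deriv hV
  have hVz : V ∈ nhds z := hV.mem_nhds hz
  have hfirst : ∀ w ∈ V, wirtingerZ (fun w => (u w : ℂ)) w =
      starRingEnd ℂ (G w) * deriv G w * (1 + G w * starRingEnd ℂ (G w))⁻¹ -
        1 / 2 * (deriv (deriv G) w / deriv G w) := by
    intro w hw
    have hVw : V ∈ nhds w := hV.mem_nhds hw
    simp only [hu]
    exact wirtingerZ_log_one_add_norm_sq_div (hG.differentiableAt hVw)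
      (hG'.differentiableAt hVw) (hG'ne w hw)
  have hne := hG'ne z hz
  have hD := Complex.one_add_mul_conj_ne_zero (G z)
  have hW := HasWirtingerAt.of_hasDerivAt (hG.differentiableAt hVz).hasDerivAt
  have hW' := HasWirtingerAt.of_hasDerivAt (hG'.differentiableAt hVz).hasDerivAt
  have hquot := HasWirtingerAt.of_hasDerivAt
    (((hG''.differentiableAt hVz).div (hG'.differentiableAt hVz) hne).hasDerivAt.const_mul (1 / 2))
  have hinv := (hW.mul hW.conj).comp (h := fun t => (1 + t)⁻¹)
    (((hasDerivAt_id _).const_add 1).fun_inv hD)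
  have hsecond := (((hW.conj.mul hW').mul hinv).sub hquot).congr_of_eventuallyEq
    (Filter.eventually_of_mem hVz hfirst)
  rw [hsecond.wirtingerZ_eq, hfirst z hz, schwarzian,
    show (fun w => deriv (deriv G) w / deriv G w) = deriv (deriv G) / deriv G from rfl]
  simp only [map_zero, mul_zero, add_zero, zero_mul, zero_add]
  generalize 1 + G z * starRingEnd ℂ (G z) = D at hD ⊢
  field_simp
  ring
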